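/- Adjoint representation of the control-to-state map (classical form of Lemma 2.1/Lemma 3.1 of the paper). Let k, m ≥ 1, n = k+m, T > 0. Let λ₁,…,λ_{k+m} : [0,1] → (0,∞) be C¹ functions; set Σ(x) = diag(−λ₁(x),…,−λ_k(x), λ_{k+1}(x),…,λ_{k+m}(x)), Σ₋(x) = diag(−λ₁(x),…,−λ_k(x)), Σ₊(x) = diag(λ_{k+1}(x),…,λ_{k+m}(x)), and let Σ′ be the derivative of Σ. Let B ∈ ℝ^{k×m}, let C : [0,T] × [0,1] → ℝ^{n×n} be continuous, and let u, v : [0,T] × [0,1] → ℝⁿ be continuously differentiable with: ∂_t u = Σ(x)∂_x u + C(t,x)u, u₋(t,0) = B u₊(t,0) for all t, and u(0,x) = 0 for all x ∈ [0,1]; ∂_t v = Σ(x)∂_x v + (Σ′(x) − C(t,x)ᵀ)v, v₋(t,1) = 0 for all t, and Σ₊(0) v₊(t,0) = −Bᵀ Σ₋(0) v₋(t,0) for all t. Then ∫₀¹ ⟨u(T,x), v(T,x)⟩ dx = ∫₀ᵀ ⟨u₊(t,1), Σ₊(1) v₊(t,1)⟩ dt. -/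

import Mathlib

open Set

theorem ftc_aux (a b : ℝ) (hab : a ≤ b) (f g : ℝ → ℝ)
    (hd : ∀ x ∈ Icc a b, HasDerivWithinAt f (g x) (Icc a b) x)
    (hg : ContinuousOn g (Icc a b)) : ∫ x in a..b, g x = f b - f a := by
  apply intervalIntegral.integral_eq_sub_of_hasDerivAt_of_le hab
  · exact fun x hx => (hd x hx).continuousWithinAt
  · exact fun x hx => (hd x (Ioo_subset_Icc_self hx)).hasDerivAt (Icc_mem_nhds hx.1 hx.2)
  · exact ContinuousOn.intervalIntegrable_of_Icc hab hg

/-- Adjoint representation of the control-to-state map (classical form of Lemma 2.1/Lemma 3.1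
of the paper). Here `n = k + m`, `Σ(x) = diag(−λ₁(x),…,−λ_k(x), λ_{k+1}(x),…,λ_{k+m}(x))`, the
direct solution `u` satisfies `u₋(t,0) = B u₊(t,0)` and `u(0,·) = 0`, and the adjoint solution
`v` satisfies `v₋(t,1) = 0` and `Σ₊(0) v₊(t,0) = −Bᵀ Σ₋(0) v₋(t,0)`; the duality pairing at
time `T` equals the pairing of the control `u₊(·,1)` with the observation `Σ₊(1) v₊(·,1)`. -/
theorem stmt14 (k m : ℕ) (hk : 1 ≤ k) (hm : 1 ≤ m) (T : ℝ) (hT : 0 < T)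
    (lam lam' : Fin (k + m) → ℝ → ℝ)
    (hpos : ∀ i, ∀ x ∈ Icc (0:ℝ) 1, 0 < lam i x)
    (hlam : ∀ i, ∀ x ∈ Icc (0:ℝ) 1, HasDerivWithinAt (lam i) (lam' i x) (Icc 0 1) x)
    (hlamc : ∀ i, ContinuousOn (lam' i) (Icc 0 1))
    (B : Matrix (Fin k) (Fin m) ℝ)
    (C : ℝ → ℝ → Fin (k + m) → Fin (k + m) → ℝ)
    (hC : ContinuousOn (fun p : ℝ × ℝ => C p.1 p.2) (Icc 0 T ×ˢ Icc 0 1))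
    (u ut ux v vt vx : ℝ → ℝ → Fin (k + m) → ℝ)
    (hu : ContinuousOn (fun p : ℝ × ℝ => u p.1 p.2) (Icc 0 T ×ˢ Icc 0 1))
    (hutc : ContinuousOn (fun p : ℝ × ℝ => ut p.1 p.2) (Icc 0 T ×ˢ Icc 0 1))
    (huxc : ContinuousOn (fun p : ℝ × ℝ => ux p.1 p.2) (Icc 0 T ×ˢ Icc 0 1))
    (hv : ContinuousOn (fun p : ℝ × ℝ => v p.1 p.2) (Icc 0 T ×ˢ Icc 0 1))
    (hvtc : ContinuousOn (fun p : ℝ × ℝ => vt p.1 p.2) (Icc 0 T ×ˢ Icc 0 1))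
    (hvxc : ContinuousOn (fun p : ℝ × ℝ => vx p.1 p.2) (Icc 0 T ×ˢ Icc 0 1))
    (hut : ∀ t ∈ Icc (0:ℝ) T, ∀ x ∈ Icc (0:ℝ) 1, ∀ i,
      HasDerivWithinAt (fun s => u s x i) (ut t x i) (Icc 0 T) t)
    (hux : ∀ t ∈ Icc (0:ℝ) T, ∀ x ∈ Icc (0:ℝ) 1, ∀ i,
      HasDerivWithinAt (fun y => u t y i) (ux t x i) (Icc 0 1) x)
    (hvt : ∀ t ∈ Icc (0:ℝ) T, ∀ x ∈ Icc (0:ℝ) 1, ∀ i,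
      HasDerivWithinAt (fun s => v s x i) (vt t x i) (Icc 0 T) t)
    (hvx : ∀ t ∈ Icc (0:ℝ) T, ∀ x ∈ Icc (0:ℝ) 1, ∀ i,
      HasDerivWithinAt (fun y => v t y i) (vx t x i) (Icc 0 1) x)
    -- direct system: ∂_t u = Σ(x) ∂_x u + C(t,x) u
    (hupde : ∀ t ∈ Icc (0:ℝ) T, ∀ x ∈ Icc (0:ℝ) 1, ∀ i : Fin (k + m),
      ut t x i = (if (i : ℕ) < k then -lam i x else lam i x) * ux t x i +
        ∑ j, C t x i j * u t x j)
    -- u₋(t,0) = B u₊(t,0)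
    (hu0 : ∀ t ∈ Icc (0:ℝ) T, ∀ j : Fin k,
      u t 0 (Fin.castAdd m j) = ∑ i : Fin m, B j i * u t 0 (Fin.natAdd k i))
    -- u(0,·) = 0
    (hu0' : ∀ x ∈ Icc (0:ℝ) 1, ∀ i : Fin (k + m), u 0 x i = 0)
    -- adjoint system: ∂_t v = Σ(x) ∂_x v + (Σ′(x) − C(t,x)ᵀ) v
    (hvpde : ∀ t ∈ Icc (0:ℝ) T, ∀ x ∈ Icc (0:ℝ) 1, ∀ i : Fin (k + m),
      vt t x i = (if (i : ℕ) < k then -lam i x else lam i x) * vx t x i +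
        (if (i : ℕ) < k then -lam' i x else lam' i x) * v t x i -
        ∑ j, C t x j i * v t x j)
    -- v₋(t,1) = 0
    (hv1 : ∀ t ∈ Icc (0:ℝ) T, ∀ j : Fin k, v t 1 (Fin.castAdd m j) = 0)
    -- Σ₊(0) v₊(t,0) = −Bᵀ Σ₋(0) v₋(t,0)
    (hv0 : ∀ t ∈ Icc (0:ℝ) T, ∀ i : Fin m,
      lam (Fin.natAdd k i) 0 * v t 0 (Fin.natAdd k i) =
        -∑ j : Fin k, B j i * (-lam (Fin.castAdd m j) 0 * v t 0 (Fin.castAdd m j))) :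
    (∫ x in (0:ℝ)..1, ∑ i, u T x i * v T x i) =
      ∫ t in (0:ℝ)..T, ∑ i : Fin m,
        u t 1 (Fin.natAdd k i) * (lam (Fin.natAdd k i) 1 * v t 1 (Fin.natAdd k i)) := by
  set G : ℝ → ℝ → ℝ := fun t x => ∑ i, (ut t x i * v t x i + u t x i * vt t x i) with hG
  have hGc : ContinuousOn (fun p : ℝ × ℝ => G p.1 p.2) (Icc 0 T ×ˢ Icc 0 1) := by
    rw [continuousOn_pi] at hu hutc hv hvtc
    apply continuousOn_finsetSum
    intro i _
    exact ((hutc i).mul (hv i)).add ((hu i).mul (hvtc i))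
  have h1 : ∀ x ∈ Icc (0:ℝ) 1, ∫ t in (0:ℝ)..T, G t x = ∑ i, u T x i * v T x i := by
    intro x hx
    rw [ftc_aux 0 T hT.le (fun t => ∑ i, u t x i * v t x i) (fun t => G t x)]
    · simp [hu0' x hx]
    · intro t ht
      exact HasDerivWithinAt.fun_sum fun i _ => (hut t ht x hx i).mul (hvt t ht x hx i)
    · exact hGc.comp (f := fun t : ℝ => (t, x)) (by fun_prop) (fun t ht => ⟨ht, hx⟩)
  have h2 : ∀ t ∈ Icc (0:ℝ) T, ∫ x in (0:ℝ)..1, G t x = ∑ i : Fin m,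
        u t 1 (Fin.natAdd k i) * (lam (Fin.natAdd k i) 1 * v t 1 (Fin.natAdd k i)) := by
    intro t ht
    rw [ftc_aux 0 1 zero_le_one (fun x => ∑ i : Fin (k + m),
      ((if (i : ℕ) < k then -lam i x else lam i x) * u t x i) * v t x i) (fun x => G t x)]
    · have e0 : ∑ i : Fin (k + m),
          ((if (i : ℕ) < k then -lam i 0 else lam i 0) * u t 0 i) * v t 0 i = 0 := by
        rw [Fin.sum_univ_add]
        have a1 : ∀ i : Fin m, lam (Fin.natAdd k i) 0 * u t 0 (Fin.natAdd k i) *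
            v t 0 (Fin.natAdd k i) = ∑ j : Fin k, B j i * u t 0 (Fin.natAdd k i) *
              (lam (Fin.castAdd m j) 0 * v t 0 (Fin.castAdd m j)) := by
          intro i
          rw [mul_right_comm, hv0 t ht i, ← Finset.sum_neg_distrib, Finset.sum_mul]
          exact Finset.sum_congr rfl fun j _ => by ring
        have a2 : ∀ j : Fin k, -lam (Fin.castAdd m j) 0 * u t 0 (Fin.castAdd m j) *
            v t 0 (Fin.castAdd m j) = -∑ i : Fin m, B j i * u t 0 (Fin.natAdd k i) *
              (lam (Fin.castAdd m j) 0 * v t 0 (Fin.castAdd m j)) := by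
          intro j
          rw [hu0 t ht j, ← Finset.sum_mul]
          ring
        simp only [Fin.val_castAdd, Fin.is_lt, if_true, Fin.val_natAdd, a2,
          not_lt.2 (Nat.le_add_right k _), if_false, a1, Finset.sum_neg_distrib]
        rw [Finset.sum_comm]
        ring
      simp only [e0, sub_zero]
      rw [Fin.sum_univ_add]
      simp only [hv1 t ht, mul_zero, Finset.sum_const_zero, zero_add, Fin.val_natAdd,
          not_lt.2 (Nat.le_add_right k _), if_false]
      exact Finset.sum_congr rfl fun j _ => by ring
    · intro x hx
      have hd := HasDerivWithinAt.fun_sum (u := (Finset.univ : Finset (Fin (k + m))))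
        (A := fun i y => ((if (i : ℕ) < k then -lam i y else lam i y) * u t y i) * v t y i)
        (A' := fun i => ((if (i : ℕ) < k then -lam' i x else lam' i x) * u t x i
          + (if (i : ℕ) < k then -lam i x else lam i x) * ux t x i) * v t x i
          + ((if (i : ℕ) < k then -lam i x else lam i x) * u t x i) * vx t x i)
        (s := Icc 0 1) (x := x) (fun i _ => by
          refine HasDerivWithinAt.mul (HasDerivWithinAt.mul ?_ (hux t ht x hx i))
            (hvx t ht x hx i)
          split_ifs
          · exact (hlam i x hx).neg
          · exact hlam i x hx)
      refine hd.congr_deriv (Eq.symm ?_)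
      have hc : ∑ i, (∑ j, C t x i j * u t x j) * v t x i
          = ∑ i, u t x i * ∑ j, C t x j i * v t x j := by
        simp only [Finset.sum_mul, Finset.mul_sum]
        rw [Finset.sum_comm]
        exact Finset.sum_congr rfl fun i _ => Finset.sum_congr rfl fun j _ => by ring
      rw [← sub_eq_zero] at hc ⊢
      rw [← hc, ← Finset.sum_sub_distrib]
      rw [← Finset.sum_sub_distrib]
      refine Finset.sum_congr rfl fun i _ => ?_
      rw [hupde t ht x hx i, hvpde t ht x hx i]
      ring
    · exact hGc.comp (f := fun x : ℝ => (t, x)) (by fun_prop) (fun x hx => ⟨ht, hx⟩)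
  have hsw : ∫ t in (0:ℝ)..T, ∫ x in (0:ℝ)..1, G t x
      = ∫ x in (0:ℝ)..1, ∫ t in (0:ℝ)..T, G t x := by
    apply MeasureTheory.intervalIntegral_intervalIntegral_swap
    rw [uIoc_of_le hT.le, uIoc_of_le zero_le_one]
    exact (ContinuousOn.integrableOn_compact (isCompact_Icc.prod isCompact_Icc) hGc).mono_set
      (prod_mono Ioc_subset_Icc_self Ioc_subset_Icc_self)
  calc _ = ∫ x in (0:ℝ)..1, ∫ t in (0:ℝ)..T, G t x := by
        refine intervalIntegral.integral_congr fun x hx => ?_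
        rw [uIcc_of_le zero_le_one] at hx
        exact (h1 x hx).symm
    _ = _ := by
        rw [← hsw]
        refine intervalIntegral.integral_congr fun t ht => ?_
        rw [uIcc_of_le hT.le] at ht
        exact h2 t ht
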